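/- For all integers m ≥ 3 and n ≥ 2, the Cartesian product W_m □ P_n of a wheel and a path satisfies tndi(W_m □ P_n) = Δ + 1 if n = 3 and m ≥ 4, and tndi(W_m □ P_n) = Δ + 2 otherwise, where Δ is the maximum degree of W_m □ P_n (so Δ = m + 1 if n = 2 and Δ = m + 2 if n ≥ 3). -/

import Mathlib

open Finset SimpleGraph

/-- A neighbor-sum-distinguishing proper total `k`-coloring of `G`:
vertex colors `cv` and edge colors `ce` taken from `{1, …, k}`, proper on
vertices, edges, and incidences, and distinguishing adjacent vertices by the
total sum of colors at each vertex. -/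
def IsProperTotalColoring {V : Type*} [Fintype V] (G : SimpleGraph V) (k : ℕ)
    (cv : V → ℕ) (ce : Sym2 V → ℕ) : Prop :=
  (∀ v, cv v ∈ Finset.Icc 1 k) ∧
  (∀ u v, G.Adj u v → ce s(u, v) ∈ Finset.Icc 1 k) ∧
  (∀ u v, G.Adj u v → cv u ≠ cv v) ∧
  (∀ u v w, G.Adj u v → G.Adj u w → v ≠ w → ce s(u, v) ≠ ce s(u, w)) ∧
  (∀ u v, G.Adj u v → ce s(u, v) ≠ cv u ∧ ce s(u, v) ≠ cv v)

open Classical in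
/-- The total color-sum at a vertex: the color of `v` plus the colors of all
edges incident with `v`. -/
noncomputable def totalSum {V : Type*} [Fintype V] (G : SimpleGraph V)
    (cv : V → ℕ) (ce : Sym2 V → ℕ) (v : V) : ℕ :=
  cv v + ∑ w ∈ Finset.univ.filter (fun w => G.Adj v w), ce s(v, w)

/-- A neighbor-sum-distinguishing proper total `k`-coloring. -/
def IsNSDColoring {V : Type*} [Fintype V] (G : SimpleGraph V) (k : ℕ)
    (cv : V → ℕ) (ce : Sym2 V → ℕ) : Prop :=
  IsProperTotalColoring G k cv ce ∧
  ∀ u v, G.Adj u v → totalSum G cv ce u ≠ totalSum G cv ce v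

/-- `tndi G` is the least `k` such that `G` admits a neighbor-sum-distinguishing
proper total `k`-coloring. -/
noncomputable def tndi {V : Type*} [Fintype V] (G : SimpleGraph V) : ℕ :=
  sInf {k | ∃ cv ce, IsNSDColoring G k cv ce}

/-- The maximum degree of a finite simple graph. -/
noncomputable def maxDeg {V : Type*} [Fintype V] (G : SimpleGraph V) : ℕ :=
  @SimpleGraph.maxDegree V G _ (Classical.decRel _)

/-- The star `S_n = K_{1,n}` with center `0` and `n` leaves. -/
def starGraph (n : ℕ) : SimpleGraph (Fin (n + 1)) :=
  SimpleGraph.fromRel fun i _ => i = 0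

/-- The wheel `W_m`: hub `0` joined to every vertex of the cycle on `1, …, m`. -/
def wheelGraph (m : ℕ) : SimpleGraph (Fin (m + 1)) :=
  SimpleGraph.fromRel fun i j =>
    i = 0 ∨ (j.val = i.val + 1 ∧ 2 ≤ j.val) ∨ (i.val = m ∧ j.val = 1)

/-! ### Degrees and lower bounds -/

section LowerBound

variable {V : Type*} [Fintype V] {G : SimpleGraph V} {k : ℕ} {cv : V → ℕ} {ce : Sym2 V → ℕ}

open Classical in
/-- The set of colors appearing at a vertex `v`: on `v` itself and on its incident edges. -/
noncomputable def colorsAt (G : SimpleGraph V) (cv : V → ℕ) (ce : Sym2 V → ℕ) (v : V) :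
    Finset ℕ :=
  insert (cv v) ((univ.filter fun w => G.Adj v w).image fun w => ce s(v, w))

open Classical in
lemma IsProperTotalColoring.notMem_image (h : IsProperTotalColoring G k cv ce) (v : V) :
    cv v ∉ (univ.filter fun w => G.Adj v w).image fun w => ce s(v, w) := by
  simp only [mem_image, mem_filter, mem_univ, true_and, not_exists, not_and]
  exact fun w hw => (h.2.2.2.2 v w hw).1

open Classical in
lemma IsProperTotalColoring.injOn (h : IsProperTotalColoring G k cv ce) (v : V) :
    Set.InjOn (fun w => ce s(v, w)) (univ.filter fun w => G.Adj v w : Finset V) := by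
  intro a ha b hb hab
  simp only [coe_filter, mem_univ, true_and, Set.mem_ofPred_eq] at ha hb
  by_contra hne
  exact h.2.2.2.1 v a b ha hb hne hab

lemma IsProperTotalColoring.sum_colorsAt (h : IsProperTotalColoring G k cv ce) (v : V) :
    ∑ c ∈ colorsAt G cv ce v, c = totalSum G cv ce v := by
  rw [colorsAt, sum_insert (h.notMem_image v), sum_image (h.injOn v), totalSum]

lemma IsProperTotalColoring.card_colorsAt (h : IsProperTotalColoring G k cv ce) (v : V)
    [Fintype (G.neighborSet v)] : #(colorsAt G cv ce v) = G.degree v + 1 := by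
  classical
  rw [colorsAt, card_insert_of_notMem (h.notMem_image v), card_image_of_injOn (h.injOn v),
    ← card_neighborFinset_eq_degree]
  congr 2
  ext w
  simp

lemma IsProperTotalColoring.colorsAt_subset (h : IsProperTotalColoring G k cv ce) (v : V) :
    colorsAt G cv ce v ⊆ Icc 1 k := by
  intro c hc
  simp only [colorsAt, mem_insert, mem_image, mem_filter, mem_univ, true_and] at hc
  obtain rfl | ⟨w, hw, rfl⟩ := hc
  · exact h.1 v
  · exact h.2.1 v w hw

lemma IsProperTotalColoring.degree_lt (h : IsProperTotalColoring G k cv ce) (v : V)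
    [Fintype (G.neighborSet v)] : G.degree v + 1 ≤ k := by
  simpa [h.card_colorsAt v] using card_le_card (h.colorsAt_subset v)

lemma IsProperTotalColoring.totalSum_eq (h : IsProperTotalColoring G k cv ce) (v : V)
    [Fintype (G.neighborSet v)] (hv : G.degree v + 1 = k) :
    totalSum G cv ce v = ∑ c ∈ Icc 1 k, c := by
  rw [← h.sum_colorsAt v, eq_of_subset_of_card_le (h.colorsAt_subset v)]
  simp [h.card_colorsAt v, hv]

lemma IsNSDColoring.degree_add_two_le (h : IsNSDColoring G k cv ce) {u v : V} (huv : G.Adj u v)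
    [Fintype (G.neighborSet u)] [Fintype (G.neighborSet v)] (hd : G.degree u = G.degree v) :
    G.degree u + 2 ≤ k := by
  by_contra hk
  have hu := h.1.degree_lt u
  exact h.2 u v huv ((h.1.totalSum_eq u (by omega)).trans (h.1.totalSum_eq v (by omega)).symm)

lemma tndi_eq (h : IsNSDColoring G k cv ce)
    (hle : ∀ j cv ce, IsNSDColoring G j cv ce → k ≤ j) : tndi G = k :=
  le_antisymm (Nat.sInf_le ⟨cv, ce, h⟩)
    (le_csInf ⟨k, cv, ce, h⟩ fun j ⟨cv, ce, hj⟩ => hle j cv ce hj)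

end LowerBound

instance wheelGraph.decidableAdj (m : ℕ) : DecidableRel (wheelGraph m).Adj := fun i j =>
  decidable_of_iff _ (fromRel_adj _ i j).symm

lemma pathGraph_sum_neighbors {n : ℕ} (l : Fin n) (F : ℕ → ℕ) [DecidableRel (pathGraph n).Adj] :
    ∑ l' ∈ univ.filter (fun l' => (pathGraph n).Adj l l'), F (min l.val l'.val) =
      (if 0 < l.val then F (l - 1) else 0) + if l + 1 < n then F l else 0 := by
  have key : ∀ l' : Fin n, (if (pathGraph n).Adj l l' then F (min l.val l'.val) else 0) =
      (if l'.val + 1 = l.val then F (l - 1) else 0) + if l.val + 1 = l'.val then F l else 0 := by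
    intro l'
    rw [if_congr pathGraph_adj rfl rfl]
    split_ifs <;> first | omega | (simp; done) | skip
    · rw [add_zero]; congr 1; omega
    · rw [zero_add]; congr 1; omega
  rw [sum_filter, sum_congr rfl fun l' _ => key l', sum_add_distrib,
    Fin.sum_univ_eq_sum_range (fun j => if j + 1 = l.val then F (l - 1) else 0),
    Fin.sum_univ_eq_sum_range (fun j => if l.val + 1 = j then F l else 0)]
  congr 1
  · split_ifs with h
    · rw [sum_eq_single_of_mem (l.val - 1) (by simp; omega) fun b _ hb => if_neg (by omega),
        if_pos (by omega)]
    · exact sum_eq_zero fun b _ => if_neg (by omega)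
  · simp

lemma pathGraph_degree {n : ℕ} (l : Fin n) [Fintype ((pathGraph n).neighborSet l)] :
    (pathGraph n).degree l =
      (if 0 < l.val then 1 else 0) + if l.val + 1 < n then 1 else 0 := by
  classical
  rw [← pathGraph_sum_neighbors l fun _ => 1, ← card_neighborFinset_eq_degree, card_eq_sum_ones]
  congr 1
  ext
  simp

lemma wheelGraph_adj_zero {m : ℕ} {j : Fin (m + 1)} : (wheelGraph m).Adj 0 j ↔ j ≠ 0 := by
  simp [wheelGraph, fromRel_adj, eq_comm]

lemma wheelGraph_adj_rim {m : ℕ} {i j : Fin (m + 1)} (hm : 3 ≤ m) (hi : i ≠ 0) :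
    (wheelGraph m).Adj i j ↔ j.val = 0 ∨ j.val = (if i.val = m then 1 else i.val + 1) ∨
      j.val = (if i.val = 1 then m else i.val - 1) := by
  have := i.isLt
  have := j.isLt
  simp only [wheelGraph, fromRel_adj, ne_eq, Fin.ext_iff, Fin.val_zero] at hi ⊢
  split_ifs <;> omega

lemma wheelGraph_degree_zero (m : ℕ) [Fintype ((wheelGraph m).neighborSet 0)] :
    (wheelGraph m).degree 0 = m := by
  have : (wheelGraph m).neighborFinset 0 = univ.erase 0 := by
    ext j
    simp [wheelGraph_adj_zero]
  rw [← card_neighborFinset_eq_degree, this]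
  simp

lemma wheelGraph_sum_rim {m : ℕ} (hm : 3 ≤ m) {i : Fin (m + 1)} (hi : i ≠ 0) (F : ℕ → ℕ) :
    ∑ j ∈ univ.filter (fun j => (wheelGraph m).Adj i j), F j.val =
      F 0 + F (if i.val = m then 1 else i.val + 1) + F (if i.val = 1 then m else i.val - 1) := by
  have hi' : i.val ≠ 0 := fun h => hi (Fin.ext h)
  have := i.isLt
  obtain ⟨a, ha⟩ : ∃ a : Fin (m + 1), a.val = if i.val = m then 1 else i.val + 1 :=
    ⟨⟨if i.val = m then 1 else i.val + 1, by split_ifs <;> omega⟩, rfl⟩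
  obtain ⟨b, hb⟩ : ∃ b : Fin (m + 1), b.val = if i.val = 1 then m else i.val - 1 :=
    ⟨⟨if i.val = 1 then m else i.val - 1, by split_ifs <;> omega⟩, rfl⟩
  have hN : univ.filter (fun j => (wheelGraph m).Adj i j) = {0, a, b} := by
    ext j
    simp only [mem_filter, mem_univ, true_and, wheelGraph_adj_rim hm hi, mem_insert,
      mem_singleton, Fin.ext_iff, ha, hb, Fin.val_zero]
  rw [← ha, ← hb, hN, sum_insert, sum_insert, sum_singleton, Fin.val_zero, add_assoc]
  · rw [mem_singleton, Fin.ext_iff, ha, hb]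
    split_ifs <;> omega
  · have ha0 : a.val ≠ 0 := by rw [ha]; split_ifs <;> omega
    have hb0 : b.val ≠ 0 := by rw [hb]; split_ifs <;> omega
    simp [Fin.ext_iff, ha0.symm, hb0.symm]

lemma wheelGraph_degree_rim {m : ℕ} (hm : 3 ≤ m) {i : Fin (m + 1)} (hi : i ≠ 0)
    [Fintype ((wheelGraph m).neighborSet i)] : (wheelGraph m).degree i = 3 := by
  rw [← card_neighborFinset_eq_degree, card_eq_sum_ones]
  refine Eq.trans ?_ (wheelGraph_sum_rim hm hi fun _ => 1)
  congr 1
  ext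
  simp

lemma wheelGraph_boxProd_degree {m n : ℕ} (hm : 3 ≤ m) (v : Fin (m + 1) × Fin n)
    [Fintype (((wheelGraph m).boxProd (pathGraph n)).neighborSet v)] :
    ((wheelGraph m).boxProd (pathGraph n)).degree v = (if v.1 = 0 then m else 3) +
      ((if 0 < v.2.val then 1 else 0) + if v.2.val + 1 < n then 1 else 0) := by
  classical
  rw [← pathGraph_degree v.2]
  have : (wheelGraph m).degree v.1 = if v.1 = 0 then m else 3 := by
    split_ifs with h
    · rw [h, wheelGraph_degree_zero]
    · exact wheelGraph_degree_rim hm h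
  rw [← this]
  convert degree_boxProd v

lemma maxDeg_eq {V : Type*} [Fintype V] {G : SimpleGraph V} {d : ℕ} (v : V)
    (hle : ∀ (u : V) [Fintype (G.neighborSet u)], G.degree u ≤ d)
    (hv : ∀ [Fintype (G.neighborSet v)], G.degree v = d) : maxDeg G = d := by
  let : DecidableRel G.Adj := Classical.decRel _
  refine le_antisymm (maxDegree_le_of_forall_degree_le _ _ fun u => hle u) ?_
  exact hv.symm.trans_le (degree_le_maxDegree _ v)

lemma maxDeg_wheelGraph_boxProd {m n : ℕ} (hm : 3 ≤ m) (hn : 2 ≤ n) :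
    maxDeg ((wheelGraph m).boxProd (pathGraph n)) = if n = 2 then m + 1 else m + 2 := by
  apply maxDeg_eq (0, ⟨1, hn⟩)
  · intro u _
    rw [wheelGraph_boxProd_degree hm]
    have := u.2.isLt
    split_ifs <;> omega
  · intro _
    rw [wheelGraph_boxProd_degree hm]
    simp only [if_true]
    split_ifs <;> omega

/-- Two adjacent vertices of maximum degree exist unless `n = 3` and `4 ≤ m`. -/
lemma IsNSDColoring.le_of_wheelGraph_boxProd {m n k : ℕ} (hm : 3 ≤ m) (hn : 2 ≤ n)
    {cv : Fin (m + 1) × Fin n → ℕ} {ce : Sym2 (Fin (m + 1) × Fin n) → ℕ}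
    (h : IsNSDColoring ((wheelGraph m).boxProd (pathGraph n)) k cv ce) :
    (if n = 2 then m + 3 else if n = 3 ∧ 4 ≤ m then m + 3 else m + 4) ≤ k := by
  classical
  by_cases h2 : n = 2
  · subst h2
    have hadj : ((wheelGraph m).boxProd (pathGraph 2)).Adj (0, 0) (0, 1) := by
      simp [boxProd_adj, pathGraph_adj]
    have := h.degree_add_two_le hadj (by simp [wheelGraph_boxProd_degree hm])
    simpa [wheelGraph_boxProd_degree hm, add_assoc] using this
  by_cases h3 : n = 3
  · subst h3
    by_cases h4 : 4 ≤ m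
    · have := h.1.degree_lt (0, 1)
      simpa [wheelGraph_boxProd_degree hm, h4, add_assoc] using this
    · obtain rfl : m = 3 := by omega
      have hadj : ((wheelGraph 3).boxProd (pathGraph 3)).Adj (0, 1) (1, 1) := by
        simp [boxProd_adj, wheelGraph_adj_zero]
      have := h.degree_add_two_le hadj (by simp [wheelGraph_boxProd_degree hm])
      simpa [wheelGraph_boxProd_degree hm, add_assoc] using this
  · have hadj : ((wheelGraph m).boxProd (pathGraph n)).Adj (0, ⟨1, by omega⟩)
        (0, ⟨2, by omega⟩) := by
      simp [boxProd_adj, pathGraph_adj]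
    have h3' : 2 < n := by omega
    have h4' : 3 < n := by omega
    have := h.degree_add_two_le hadj (by simp [wheelGraph_boxProd_degree hm, h3', h4'])
    simpa [wheelGraph_boxProd_degree hm, add_assoc, h2, h3, h3', h4'] using this

/-! ### Colorings of `G □ P_n` described layer by layer -/

section BoxProd

variable {V : Type*} [DecidableEq V] {G : SimpleGraph V}

/-- The edge coloring of `G □ P_n` assembled from layer and path edge colors. -/
def layeredEdge {n : ℕ} (W : ℕ → V → V → ℕ) (P : ℕ → V → ℕ) (hW : ∀ l i j, W l i j = W l j i) :
    Sym2 (V × Fin n) → ℕ :=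
  Sym2.lift ⟨fun u v => if u.1 = v.1 then P (min u.2.val v.2.val) u.1
    else W (min u.2.val v.2.val) u.1 v.1, fun u v => by
      simp only [min_comm u.2.val, hW _ u.1 v.1, eq_comm (a := u.1)]
      split_ifs with h
      · rw [h]
      · rfl⟩

variable {n k : ℕ} {cv : ℕ → V → ℕ} {W : ℕ → V → V → ℕ} {P : ℕ → V → ℕ}

lemma layeredEdge_layer (hW : ∀ l i j, W l i j = W l j i) {i j : V} (l : Fin n) (h : G.Adj i j) :
    layeredEdge W P hW s((i, l), (j, l)) = W l i j := by
  simp [layeredEdge, h.ne]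

lemma layeredEdge_path (hW : ∀ l i j, W l i j = W l j i) (i : V) (l l' : Fin n) :
    layeredEdge W P hW s((i, l), (i, l')) = P (min l.val l'.val) i := by
  simp [layeredEdge]

variable [Fintype V] [DecidableRel G.Adj]

/-- The color sum at the vertex `(i, l)` of `G □ P_n`, where layer `l` has vertex colors `cv l`
and edge colors `W l`, and the edge from `(i, l)` to `(i, l + 1)` has color `P l i`. -/
def layeredSum (G : SimpleGraph V) [DecidableRel G.Adj] (n : ℕ) (cv : ℕ → V → ℕ)
    (W : ℕ → V → V → ℕ) (P : ℕ → V → ℕ) (l : ℕ) (i : V) : ℕ :=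
  cv l i + ∑ j ∈ univ.filter (fun j => G.Adj i j), W l i j +
    ((if 0 < l then P (l - 1) i else 0) + if l + 1 < n then P l i else 0)

/-- The layer-by-layer description of a neighbor-sum-distinguishing coloring of `G □ P_n`. -/
structure IsLayeredNSD (G : SimpleGraph V) [DecidableRel G.Adj] (n k : ℕ) (cv : ℕ → V → ℕ)
    (W : ℕ → V → V → ℕ) (P : ℕ → V → ℕ) : Prop where
  symm : ∀ l i j, W l i j = W l j i
  vertex_mem : ∀ l < n, ∀ i, cv l i ∈ Icc 1 k
  layer : ∀ l < n, ∀ i j, G.Adj i j → W l i j ∈ Icc 1 k ∧ cv l i ≠ cv l j ∧ W l i j ≠ cv l i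
  layer_edges : ∀ l < n, ∀ i j j', G.Adj i j → G.Adj i j' → j ≠ j' → W l i j ≠ W l i j'
  path : ∀ l, l + 1 < n → ∀ i, P l i ∈ Icc 1 k ∧ cv l i ≠ cv (l + 1) i ∧ P l i ≠ cv l i ∧
    P l i ≠ cv (l + 1) i
  path_layer : ∀ l, l + 1 < n → ∀ i j, G.Adj i j → P l i ≠ W l i j ∧ P l i ≠ W (l + 1) i j
  path_path : ∀ l, l + 2 < n → ∀ i, P l i ≠ P (l + 1) i
  sum_layer : ∀ l < n, ∀ i j, G.Adj i j → layeredSum G n cv W P l i ≠ layeredSum G n cv W P l j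
  sum_path : ∀ l, l + 1 < n → ∀ i, layeredSum G n cv W P l i ≠ layeredSum G n cv W P (l + 1) i

lemma totalSum_layered (hW : ∀ l i j, W l i j = W l j i) (i : V) (l : Fin n) :
    totalSum (G.boxProd (pathGraph n)) (fun v => cv v.2 v.1) (layeredEdge W P hW) (i, l) =
      layeredSum G n cv W P l i := by
  classical
  have key : ∀ w : V × Fin n,
      (if (G.boxProd (pathGraph n)).Adj (i, l) w then layeredEdge W P hW s((i, l), w) else 0) =
      (if l = w.2 then if G.Adj i w.1 then W l i w.1 else 0 else 0) +
        if i = w.1 then if (pathGraph n).Adj l w.2 then P (min l.val w.2.val) i else 0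
          else 0 := by
    rintro ⟨j, l'⟩
    rw [if_congr boxProd_adj rfl rfl]
    by_cases hl : l = l'
    · subst hl
      by_cases hij : G.Adj i j
      · simp [hij, layeredEdge_layer hW l hij]
      · simp [hij]
    · by_cases hij : i = j
      · subst hij
        simp [hl, layeredEdge_path]
      · simp [hl, hij]
  rw [totalSum, layeredSum, add_assoc, ← pathGraph_sum_neighbors l fun l => P l i]
  congr 1
  rw [sum_filter, sum_filter, sum_filter]
  trans ∑ w : V × Fin n, ((if l = w.2 then if G.Adj i w.1 then W l i w.1 else 0 else 0) +
        if i = w.1 then if (pathGraph n).Adj l w.2 then P (min l.val w.2.val) i else 0 else 0)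
  · refine sum_congr rfl fun w _ => ?_
    rw [← key w]
  rw [sum_add_distrib, Fintype.sum_prod_type, Fintype.sum_prod_type_right]
  simp

theorem IsLayeredNSD.isNSDColoring (h : IsLayeredNSD G n k cv W P) :
    IsNSDColoring (G.boxProd (pathGraph n)) k (fun v => cv v.2 v.1) (layeredEdge W P h.symm) := by
  have hE := fun (i j : V) (l : Fin n) (hij : G.Adj i j) =>
    layeredEdge_layer (P := P) h.symm l hij
  have hP := fun (i : V) (l l' : Fin n) => layeredEdge_path (P := P) h.symm i l l'
  refine ⟨⟨fun v => h.vertex_mem v.2 v.2.isLt v.1, ?_, ?_, ?_, ?_⟩, ?_⟩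
  · rintro ⟨i, l⟩ ⟨j, l'⟩ hadj
    rcases boxProd_adj.1 hadj with ⟨hij, rfl : l = l'⟩ | ⟨hll, rfl : i = j⟩
    · rw [hE i j l hij]
      exact (h.layer l l.isLt i j hij).1
    · rw [hP]
      exact (h.path _ (by rcases pathGraph_adj.1 hll with h | h <;> simp at h <;> omega) i).1
  · rintro ⟨i, l⟩ ⟨j, l'⟩ hadj
    rcases boxProd_adj.1 hadj with ⟨hij, rfl : l = l'⟩ | ⟨hll, rfl : i = j⟩
    · exact (h.layer l l.isLt i j hij).2.1
    · rcases pathGraph_adj.1 hll with e | e <;> simp only at e ⊢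
      · rw [← e]; exact (h.path l (by omega) i).2.1
      · rw [← e]; exact (h.path l' (by omega) i).2.1.symm
  · rintro ⟨i, l⟩ ⟨j, l'⟩ ⟨j', l''⟩ h1 h2 hne
    rcases boxProd_adj.1 h1 with ⟨hij, rfl : l = l'⟩ | ⟨hll, rfl : i = j⟩ <;>
    rcases boxProd_adj.1 h2 with ⟨hij', rfl : l = l''⟩ | ⟨hll', rfl : i = j'⟩
    · rw [hE i j l hij, hE i j' l hij']
      exact h.layer_edges l l.isLt i j j' hij hij' fun e => hne (by rw [e])
    · rw [hE i j l hij, hP]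
      rcases pathGraph_adj.1 hll' with e | e <;> simp only at e
      · rw [min_eq_left (by omega)]
        exact (h.path_layer l (by omega) i j hij).1.symm
      · rw [min_eq_right (by omega), ← e]
        exact (h.path_layer l'' (by omega) i j hij).2.symm
    · rw [hE i j' l hij', hP]
      rcases pathGraph_adj.1 hll with e | e <;> simp only at e
      · rw [min_eq_left (by omega)]
        exact (h.path_layer l (by omega) i j' hij').1
      · rw [min_eq_right (by omega), ← e]
        exact (h.path_layer l' (by omega) i j' hij').2
    · rw [hP, hP]
      have hne' : l'.val ≠ l''.val := fun e => hne (by rw [Fin.ext e])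
      rcases pathGraph_adj.1 hll with e | e <;> rcases pathGraph_adj.1 hll' with e' | e' <;>
        simp only at e e'
      · omega
      · rw [min_eq_left (by omega), min_eq_right (by omega), ← e']
        exact (h.path_path l'' (by omega) i).symm
      · rw [min_eq_right (by omega), min_eq_left (by omega), ← e]
        exact h.path_path l' (by omega) i
      · omega
  · rintro ⟨i, l⟩ ⟨j, l'⟩ hadj
    rcases boxProd_adj.1 hadj with ⟨hij, rfl : l = l'⟩ | ⟨hll, rfl : i = j⟩
    · rw [hE i j l hij]
      exact ⟨(h.layer l l.isLt i j hij).2.2,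
        h.symm l i j ▸ (h.layer l l.isLt j i hij.symm).2.2⟩
    · rw [hP]
      rcases pathGraph_adj.1 hll with e | e <;> simp only at e ⊢
      · rw [min_eq_left (by omega), ← e]
        exact (h.path l (by omega) i).2.2
      · rw [min_eq_right (by omega), ← e]
        exact (h.path l' (by omega) i).2.2.symm
  · rintro ⟨i, l⟩ ⟨j, l'⟩ hadj
    rw [totalSum_layered, totalSum_layered]
    rcases boxProd_adj.1 hadj with ⟨hij, rfl : l = l'⟩ | ⟨hll, rfl : i = j⟩
    · exact h.sum_layer l l.isLt i j hij
    · rcases pathGraph_adj.1 hll with e | e <;> simp only at e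
      · rw [← e]; exact h.sum_path l (by omega) i
      · rw [← e]; exact (h.sum_path l' (by omega) i).symm

end BoxProd

/-- A coloring of `G □ P_n` whose layers and path edges alternate between two patterns. -/
theorem IsLayeredNSD.of_alternating {V : Type*} [Fintype V] [DecidableEq V] {G : SimpleGraph V}
    [DecidableRel G.Adj] {n k : ℕ} (c : Bool → V → ℕ) (w : Bool → V → V → ℕ) (p : Bool → ℕ)
    (symm : ∀ t i j, w t i j = w t j i)
    (vertex_mem : ∀ t i, c t i ∈ Icc 1 k)
    (layer : ∀ t i j, G.Adj i j → w t i j ∈ Icc 1 k ∧ c t i ≠ c t j ∧ w t i j ≠ c t i)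
    (layer_edges : ∀ t i j j', G.Adj i j → G.Adj i j' → j ≠ j' → w t i j ≠ w t i j')
    (path_mem : ∀ l, l + 1 < n → p l.bodd ∈ Icc 1 k)
    (path : ∀ t i, c t i ≠ c (!t) i ∧ p t ≠ c t i ∧ p t ≠ c (!t) i)
    (path_layer : ∀ t i j, G.Adj i j → p t ≠ w t i j ∧ p t ≠ w (!t) i j)
    (path_path : p false ≠ p true)
    (sum_layer : ∀ t i j, G.Adj i j → c t i + ∑ j' ∈ univ.filter (fun j' => G.Adj i j'), w t i j' ≠
      c t j + ∑ j' ∈ univ.filter (fun j' => G.Adj j j'), w t j j')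
    (sum_path : ∀ t i, ∀ q ∈ ({0, p (!t)} : Finset ℕ),
      c t i + ∑ j ∈ univ.filter (fun j => G.Adj i j), w t i j + q ≠
        c (!t) i + ∑ j ∈ univ.filter (fun j => G.Adj i j), w (!t) i j)
    (sum_start : ∀ i, c false i + ∑ j ∈ univ.filter (fun j => G.Adj i j), w false i j ≠
        c true i + ∑ j ∈ univ.filter (fun j => G.Adj i j), w true i j + p true) :
    IsLayeredNSD G n k (fun l => c l.bodd) (fun l => w l.bodd) (fun l _ => p l.bodd) where
  symm _ := symm _
  vertex_mem _ _ := vertex_mem _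
  layer _ _ := layer _
  layer_edges _ _ := layer_edges _
  path l hl i := by
    rw [Nat.bodd_succ]
    exact ⟨path_mem l hl, path _ i⟩
  path_layer l _ := by
    rw [Nat.bodd_succ]
    exact path_layer _
  path_path l _ _ := by
    rw [Nat.bodd_succ]
    cases l.bodd
    exacts [path_path, path_path.symm]
  sum_layer l _ i j hij := by
    have := sum_layer l.bodd i j hij
    simp only [layeredSum]
    omega
  sum_path l hl i := by
    have h0 := sum_path l.bodd i 0 (by simp)
    have h1 := sum_path l.bodd i (p (!l.bodd)) (by simp)
    have hs := sum_start i
    simp only [layeredSum, Nat.bodd_succ, hl, Nat.add_sub_cancel, Nat.succ_pos, if_true]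
    rcases Nat.eq_zero_or_pos l with rfl | hl0
    · simp only [Nat.bodd_zero, Bool.not_false] at *
      split_ifs <;> omega
    · have hb : (l - 1).bodd = !l.bodd := by
        obtain ⟨l, rfl⟩ := Nat.exists_eq_succ_of_ne_zero hl0.ne'
        simp
      rw [hb]
      split_ifs <;> omega

/-- The edge coloring of the wheel with spoke colors `s` and rim colors `e`, where `e i` is the
color of the rim edge leaving `i`. -/
def wheelEdge (m : ℕ) (s e : ℕ → ℕ) (i j : Fin (m + 1)) : ℕ :=
  if i.val = 0 then s j else if j.val = 0 then s i else if j.val = i.val + 1 then e i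
  else if i.val = j.val + 1 then e j else e m

lemma wheelEdge_symm (m : ℕ) (s e : ℕ → ℕ) (i j : Fin (m + 1)) :
    wheelEdge m s e i j = wheelEdge m s e j i := by
  unfold wheelEdge
  split_ifs <;> first | rfl | omega | simp_all

lemma exists_isNSDColoring_three (n k : ℕ) (hk : n = 2 ∧ k = 6 ∨ k = 7) :
    ∃ cv ce, IsNSDColoring ((wheelGraph 3).boxProd (pathGraph n)) k cv ce := by
  have h : IsLayeredNSD (wheelGraph 3) n k _ _ _ := IsLayeredNSD.of_alternating
    (fun t => bif t then ![2, 1, 5, 3] else ![3, 4, 1, 2])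
    (fun t => bif t then wheelEdge 3 [0, 5, 4, 1].getI [0, 3, 2, 4].getI
      else wheelEdge 3 [0, 5, 4, 1].getI [0, 2, 5, 3].getI)
    (fun t => bif t then 7 else 6)
    (by decide) (by rcases hk with ⟨-, rfl⟩ | rfl <;> decide)
    (by rcases hk with ⟨-, rfl⟩ | rfl <;> decide) (by decide)
    (by
      intro l hl
      rcases hk with ⟨rfl, rfl⟩ | rfl
      · obtain rfl : l = 0 := by omega
        decide
      · cases l.bodd <;> decide)
    (by decide) (by decide) (by decide) (by decide) (by decide) (by decide)
  exact ⟨_, _, h.isNSDColoring⟩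

lemma exists_isNSDColoring_four (n k : ℕ) (hk : n = 2 ∧ k = 7 ∨ k = 8) :
    ∃ cv ce, IsNSDColoring ((wheelGraph 4).boxProd (pathGraph n)) k cv ce := by
  have h : IsLayeredNSD (wheelGraph 4) n k _ _ _ := IsLayeredNSD.of_alternating
    (fun t => bif t then ![3, 2, 4, 6, 4] else ![2, 6, 1, 3, 5])
    (fun t => bif t then wheelEdge 4 [0, 4, 5, 1, 6].getI [0, 6, 2, 5, 1].getI
      else wheelEdge 4 [0, 1, 5, 6, 3].getI [0, 3, 2, 1, 2].getI)
    (fun t => bif t then 8 else 7)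
    (by decide) (by rcases hk with ⟨-, rfl⟩ | rfl <;> decide)
    (by rcases hk with ⟨-, rfl⟩ | rfl <;> decide) (by decide)
    (by
      intro l hl
      rcases hk with ⟨rfl, rfl⟩ | rfl
      · obtain rfl : l = 0 := by omega
        decide
      · cases l.bodd <;> decide)
    (by decide) (by decide) (by decide) (by decide) (by decide) (by decide)
  exact ⟨_, _, h.isNSDColoring⟩

lemma exists_isNSDColoring_four_three :
    ∃ cv ce, IsNSDColoring ((wheelGraph 4).boxProd (pathGraph 3)) 7 cv ce := by
  have h : IsLayeredNSD (wheelGraph 4) 3 7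
      (fun l => if l = 1 then ![2, 1, 4, 1, 4] else ![1, 2, 3, 2, 3])
      (fun l => wheelEdge 4
        (if l = 1 then [0, 3, 1, 4, 5] else [0, 3, 2, 5, 4]).getI
        (if l = 0 then [0, 1, 4, 1, 5] else if l = 1 then [0, 2, 3, 2, 6]
          else [0, 1, 4, 6, 5]).getI)
      (fun l => if l = 0 then ![6, 4, 6, 6, 7] else ![7, 7, 5, 7, 1]) := by
    refine ⟨fun l => wheelEdge_symm _ _ _, by decide, by decide, by decide, ?_, ?_, ?_,
      by decide, ?_⟩
    · intro l hl
      replace hl : l < 2 := by omega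
      revert l
      decide
    · intro l hl
      replace hl : l < 2 := by omega
      revert l
      decide
    · intro l hl
      obtain rfl : l = 0 := by omega
      decide
    · intro l hl
      replace hl : l < 2 := by omega
      revert l
      decide
  exact ⟨_, _, h.isNSDColoring⟩

/-- Reduction modulo `m` of numbers in `1, …, 2 * m` to the residues `1, …, m`. -/
def wrap (m x : ℕ) : ℕ := if x ≤ m then x else x - m

lemma wrap_spec (m x : ℕ) : x ≤ m ∧ wrap m x = x ∨ m < x ∧ wrap m x = x - m := by
  unfold wrap
  split_ifs <;> omega

/-- Vertex colors of the cyclic coloring of a wheel: hub color `c`, rim colors shifted by `x`. -/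
def cyclicVertex (m c x : ℕ) (i : Fin (m + 1)) : ℕ := if i.val = 0 then c else wrap m (i + x)

/-- Edge colors of the cyclic coloring of a wheel: the spoke to `i` has color `i`, and the rim edge
leaving `i` has color `i + y`. -/
def cyclicEdge (m y : ℕ) : Fin (m + 1) → Fin (m + 1) → ℕ :=
  wheelEdge m id fun i => wrap m (i + y)

/-- The rim neighbors of `i` and the colors of the edges at `i` in the cyclic coloring. -/
lemma cyclicEdge_spec {m y : ℕ} (hm : 5 ≤ m) {i j : Fin (m + 1)}
    (hij : (wheelGraph m).Adj i j) :
    i.val = 0 ∧ j.val ≠ 0 ∧ cyclicEdge m y i j = j ∨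
    i.val ≠ 0 ∧ j.val = 0 ∧ cyclicEdge m y i j = i ∨
    i.val ≠ 0 ∧ j.val ≠ 0 ∧ (j.val = i + 1 ∨ i.val = m ∧ j.val = 1) ∧
      cyclicEdge m y i j = wrap m (i + y) ∨
    i.val ≠ 0 ∧ j.val ≠ 0 ∧ (i.val = j + 1 ∨ j.val = m ∧ i.val = 1) ∧
      cyclicEdge m y i j = wrap m (j + y) := by
  have := i.isLt
  have := j.isLt
  simp only [wheelGraph, fromRel_adj, ne_eq, Fin.ext_iff, Fin.val_zero] at hij
  simp only [cyclicEdge, wheelEdge, id]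
  split_ifs with h1 h2 h3 h4
  · omega
  · omega
  · omega
  · omega
  · by_cases h : i.val = m
    · rw [h]; omega
    · have : j.val = m := by omega
      rw [this]; omega

lemma cyclicEdge_sum_rim {m y : ℕ} (hm : 5 ≤ m) (hy : 1 ≤ y) (hy' : y < m) {i : Fin (m + 1)}
    (hi : i.val ≠ 0) :
    ∑ j ∈ univ.filter (fun j => (wheelGraph m).Adj i j), cyclicEdge m y i j =
      i + wrap m (i + y) + wrap m (i + y - 1) := by
  have := i.isLt
  have h := wheelGraph_sum_rim (m := m) (i := i) (by omega) (fun h => hi (by rw [h]; rfl))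
    fun j => if j = 0 then i.val else if j = i + 1 then wrap m (i + y)
      else if i.val = j + 1 then wrap m (j + y) else wrap m (m + y)
  simp only [cyclicEdge, wheelEdge, id, hi, if_false]
  rw [h, if_pos rfl]
  have hs : ∀ a : ℕ, a = (if i.val = m then 1 else i.val + 1) → (if a = 0 then i.val
      else if a = i + 1 then wrap m (i + y) else if i.val = a + 1 then wrap m (a + y)
      else wrap m (m + y)) = wrap m (i + y) := by
    intro a ha
    by_cases hm' : i.val = m
    · rw [if_pos hm'] at ha
      rw [if_neg (by omega), if_neg (by omega), if_neg (by omega), hm']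
    · rw [if_neg hm'] at ha
      rw [if_neg (by omega), if_pos ha]
  have hp : ∀ a : ℕ, a = (if i.val = 1 then m else i.val - 1) → (if a = 0 then i.val
      else if a = i + 1 then wrap m (i + y) else if i.val = a + 1 then wrap m (a + y)
      else wrap m (m + y)) = wrap m (i + y - 1) := by
    intro a ha
    by_cases h1 : i.val = 1
    · rw [if_pos h1] at ha
      rw [if_neg (by omega), if_neg (by omega), if_neg (by omega), h1]
      have := wrap_spec m (m + y)
      have := wrap_spec m (1 + y - 1)
      omega
    · rw [if_neg h1] at ha
      rw [if_neg (by omega), if_neg (by omega), if_pos (by omega)]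
      congr 1
      omega
  rw [hs _ rfl, hp _ rfl]

lemma cyclicEdge_sum_hub (m y : ℕ) :
    ∑ j ∈ univ.filter (fun j => (wheelGraph m).Adj 0 j), cyclicEdge m y 0 j =
      ∑ j ∈ range (m + 1), j := by
  rw [← Fin.sum_univ_eq_sum_range (fun j => j), sum_filter]
  refine sum_congr rfl fun j _ => ?_
  by_cases hj : j = 0 <;> simp [wheelGraph_adj_zero, cyclicEdge, wheelEdge, hj]

lemma four_mul_le_sum_range {m : ℕ} (hm : 3 ≤ m) : 4 * m ≤ ∑ j ∈ range (m + 1), j + 6 := by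
  induction m, hm using Nat.le_induction with
  | base => decide
  | succ m hm ih =>
    rw [sum_range_succ]
    omega

/-- Shifts of the rim colors in the two alternating cyclic patterns. -/
def rimShift (l : ℕ) : ℕ := if l % 2 = 0 then 1 else 4

/-- Shifts of the rim edge colors in the two alternating cyclic patterns. -/
def edgeShift (l : ℕ) : ℕ := if l % 2 = 0 then 3 else 2

lemma shift_spec (l : ℕ) : l % 2 = 0 ∧ rimShift l = 1 ∧ edgeShift l = 3 ∨
    l % 2 = 1 ∧ rimShift l = 4 ∧ edgeShift l = 2 := by
  unfold rimShift edgeShift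
  split_ifs <;> omega

/-- The contribution of a layer to the color sum at the rim vertex `i`. -/
def rimSum (m l i : ℕ) : ℕ :=
  wrap m (i + rimShift l) + (i + wrap m (i + edgeShift l) + wrap m (i + edgeShift l - 1))

lemma rimSum_add_six_le {m i : ℕ} (hm : 5 ≤ m) (l : ℕ) (hi : i ≤ m) :
    rimSum m l i + 6 ≤ 4 * m := by
  rcases shift_spec l with ⟨-, h1, h2⟩ | ⟨-, h1, h2⟩ <;> rw [rimSum, h1, h2] <;> unfold wrap <;>
    split_ifs <;> omega

lemma rimSum_ne_succ {m i : ℕ} (hm : 5 ≤ m) (l : ℕ) (h1 : 1 ≤ i) (hi : i + 1 ≤ m) :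
    rimSum m l i ≠ rimSum m l (i + 1) := by
  rcases shift_spec l with ⟨-, h1, h2⟩ | ⟨-, h1, h2⟩ <;> simp only [rimSum, h1, h2] <;>
    unfold wrap <;> split_ifs <;> omega

lemma rimSum_ne_wrap {m : ℕ} (hm : 5 ≤ m) (l : ℕ) : rimSum m l m ≠ rimSum m l 1 := by
  rcases shift_spec l with ⟨-, h1, h2⟩ | ⟨-, h1, h2⟩ <;> simp only [rimSum, h1, h2] <;>
    unfold wrap <;> split_ifs <;> omega

lemma rimSum_parity {m i : ℕ} (hm : 5 ≤ m) (l : ℕ) (h1 : 1 ≤ i) (hi : i ≤ m) :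
    l % 2 = 0 ∧ (rimSum m l i + 1 = rimSum m (l + 1) i ∨
      rimSum m l i + 1 = rimSum m (l + 1) i + m) ∨
    l % 2 = 1 ∧ (rimSum m (l + 1) i + 1 = rimSum m l i ∨
      rimSum m (l + 1) i + 1 = rimSum m l i + m) := by
  rcases shift_spec l with ⟨h, h1, h2⟩ | ⟨h, h1, h2⟩ <;>
    rcases shift_spec (l + 1) with ⟨h', h3, h4⟩ | ⟨h', h3, h4⟩ <;> try omega
  · refine Or.inl ⟨h, ?_⟩
    simp only [rimSum, h1, h2, h3, h4]
    unfold wrap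
    split_ifs <;> omega
  · refine Or.inr ⟨h, ?_⟩
    simp only [rimSum, h1, h2, h3, h4]
    unfold wrap
    split_ifs <;> omega

theorem isLayeredNSD_cyclic {m n k : ℕ} (hm : 5 ≤ m) (c : ℕ → ℕ)
    (hc : ∀ l < n, m < c l ∧ c l ≤ k) (hk : ∀ l, l + 1 < n → m + 1 + l % 2 ≤ k)
    (hpath : ∀ l, l + 1 < n → c l ≠ c (l + 1) ∧ m + 1 + l % 2 ≠ c l ∧
      m + 1 + l % 2 ≠ c (l + 1))
    (hsum : ∀ l, l + 1 < n → c l + (if 0 < l then m + 1 + (l - 1) % 2 else 0) ≠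
      c (l + 1) + if l + 1 + 1 < n then m + 1 + (l + 1) % 2 else 0) :
    IsLayeredNSD (wheelGraph m) n k (fun l => cyclicVertex m (c l) (rimShift l))
      (fun l => cyclicEdge m (edgeShift l)) (fun l _ => m + 1 + l % 2) := by
  have hS : ∀ l, edgeShift l < m ∧ 1 ≤ edgeShift l := fun l => by
    have := shift_spec l
    omega
  have hV : ∀ l (i : Fin (m + 1)), i.val = 0 ∧ cyclicVertex m (c l) (rimShift l) i = c l ∨
      i.val ≠ 0 ∧ cyclicVertex m (c l) (rimShift l) i = wrap m (i + rimShift l) := fun l i => by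
    unfold cyclicVertex
    split_ifs with h <;> simp [h]
  have hE : ∀ l (i j : Fin (m + 1)), (wheelGraph m).Adj i j →
      1 ≤ cyclicEdge m (edgeShift l) i j ∧ cyclicEdge m (edgeShift l) i j ≤ m := by
    intro l i j hij
    have := cyclicEdge_spec (y := edgeShift l) hm hij
    have := hS l
    have := wrap_spec m (i + edgeShift l)
    have := wrap_spec m (j + edgeShift l)
    omega
  have hT : ∀ l (i : Fin (m + 1)), ∃ S, layeredSum (wheelGraph m) n
      (fun l => cyclicVertex m (c l) (rimShift l)) (fun l => cyclicEdge m (edgeShift l))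
      (fun l _ => m + 1 + l % 2) l i =
        S + ((if 0 < l then m + 1 + (l - 1) % 2 else 0) + if l + 1 < n then m + 1 + l % 2 else 0) ∧
      (i.val = 0 ∧ S = c l + ∑ j ∈ range (m + 1), j ∨
      i.val ≠ 0 ∧ S = rimSum m l i) := by
    intro l i
    refine ⟨_, rfl, ?_⟩
    rcases hV l i with ⟨h0, h1⟩ | ⟨h0, h1⟩
    · obtain rfl : i = 0 := Fin.ext h0
      left
      exact ⟨h0, congrArg₂ _ h1 (cyclicEdge_sum_hub _ _)⟩
    · right
      exact ⟨h0, congrArg₂ _ h1 (cyclicEdge_sum_rim hm (hS l).2 (hS l).1 h0)⟩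
  have hZ := four_mul_le_sum_range (m := m) (by omega)
  refine ⟨fun l => wheelEdge_symm _ _ _, ?_, ?_, ?_, ?_, ?_, ?_, ?_, ?_⟩
  · intro l hl i
    have := hV l i
    have := wrap_spec m (i + rimShift l)
    have := shift_spec l
    have := hc l hl
    rw [mem_Icc]
    omega
  · intro l hl i j hij
    have := cyclicEdge_spec (y := edgeShift l) hm hij
    have := hE l i j hij
    have := hV l i
    have := hV l j
    have := wrap_spec m (i + rimShift l)
    have := wrap_spec m (j + rimShift l)
    have := wrap_spec m (i + edgeShift l)
    have := wrap_spec m (j + edgeShift l)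
    have := hc l hl
    rw [mem_Icc]
    refine ⟨by omega, ?_, ?_⟩ <;>
      rcases shift_spec l with ⟨-, h1, h2⟩ | ⟨-, h1, h2⟩ <;> simp only [h1, h2] at * <;> omega
  · intro l hl i j j' hij hij' hne
    have := cyclicEdge_spec (y := edgeShift l) hm hij
    have := cyclicEdge_spec (y := edgeShift l) hm hij'
    have hne' : j.val ≠ j'.val := fun e => hne (Fin.ext e)
    have := wrap_spec m (i + edgeShift l)
    have := wrap_spec m (j + edgeShift l)
    have := wrap_spec m (j' + edgeShift l)
    rcases shift_spec l with ⟨-, h1, h2⟩ | ⟨-, h1, h2⟩ <;> simp only [h1, h2] at * <;> omega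
  · intro l hl i
    have := hV l i
    have := hV (l + 1) i
    have := wrap_spec m (i + rimShift l)
    have := wrap_spec m (i + rimShift (l + 1))
    have := shift_spec l
    have := shift_spec (l + 1)
    have := hk l hl
    have := hpath l hl
    rw [mem_Icc]
    omega
  · intro l hl i j hij
    have := hE l i j hij
    have := hE (l + 1) i j hij
    omega
  · intro l hl i
    omega
  · intro l hl i j hij
    obtain ⟨S, hS1, hS2⟩ := hT l i
    obtain ⟨S', hS1', hS2'⟩ := hT l j
    rw [hS1, hS1']
    have := hc l hl
    have hij' := cyclicEdge_spec (y := edgeShift l) hm hij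
    have hRi := rimSum_add_six_le hm l i.is_le
    have hRj := rimSum_add_six_le hm l j.is_le
    suffices S ≠ S' by omega
    rcases hS2 with ⟨hi, hS2⟩ | ⟨hi, hS2⟩ <;> rcases hS2' with ⟨hj, hS2'⟩ | ⟨hj, hS2'⟩
    · omega
    · omega
    · omega
    · rw [hS2, hS2']
      have : j.val = i + 1 ∨ i.val = m ∧ j.val = 1 ∨ i.val = j + 1 ∨ j.val = m ∧ i.val = 1 := by
        omega
      rcases this with e | ⟨e, e'⟩ | e | ⟨e, e'⟩
      · rw [e]
        exact rimSum_ne_succ hm l (by omega) (by omega)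
      · rw [e, e']
        exact rimSum_ne_wrap hm l
      · rw [e]
        exact (rimSum_ne_succ hm l (by omega) (by omega)).symm
      · rw [e, e']
        exact (rimSum_ne_wrap hm l).symm
  · intro l hl i
    obtain ⟨S, hS1, hS2⟩ := hT l i
    obtain ⟨S', hS1', hS2'⟩ := hT (l + 1) i
    have := hsum l hl
    rw [hS1, hS1']
    simp only [hl, if_true, Nat.add_sub_cancel, Nat.succ_pos]
    rcases hS2 with ⟨hi, hS2⟩ | ⟨hi, hS2⟩ <;> rcases hS2' with ⟨hj, hS2'⟩ | ⟨hj, hS2'⟩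
    · omega
    · omega
    · omega
    · have := rimSum_parity hm l (by omega) i.is_le
      split_ifs <;> omega

theorem exists_isNSDColoring {m n : ℕ} (hm : 3 ≤ m) (hn : 2 ≤ n) :
    ∃ cv ce, IsNSDColoring ((wheelGraph m).boxProd (pathGraph n))
      (if n = 2 then m + 3 else if n = 3 ∧ 4 ≤ m then m + 3 else m + 4) cv ce := by
  obtain rfl | rfl | hm : m = 3 ∨ m = 4 ∨ 5 ≤ m := by omega
  · apply exists_isNSDColoring_three
    split_ifs <;> omega
  · by_cases h3 : n = 3
    · subst h3
      exact exists_isNSDColoring_four_three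
    · apply exists_isNSDColoring_four
      split_ifs <;> omega
  · refine ⟨_, _, (isLayeredNSD_cyclic hm
      (fun l => if n = 3 then if l = 2 then m + 1 else m + 2 + l
        else if n = 2 then m + 2 + l % 2 else m + 3 + l % 2) ?_ ?_ ?_ ?_).isNSDColoring⟩
    · intro l hl
      split_ifs <;> omega
    · intro l hl
      split_ifs <;> omega
    · intro l hl
      split_ifs <;> omega
    · intro l hl
      split_ifs <;> omega

theorem stmt_6 (m n : ℕ) (hm : 3 ≤ m) (hn : 2 ≤ n) :
    (n = 2 → maxDeg ((wheelGraph m).boxProd (pathGraph n)) = m + 1) ∧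
    (3 ≤ n → maxDeg ((wheelGraph m).boxProd (pathGraph n)) = m + 2) ∧
    tndi ((wheelGraph m).boxProd (pathGraph n)) =
      (if n = 3 ∧ 4 ≤ m then maxDeg ((wheelGraph m).boxProd (pathGraph n)) + 1
       else maxDeg ((wheelGraph m).boxProd (pathGraph n)) + 2) := by
  obtain ⟨cv, ce, h⟩ := exists_isNSDColoring hm hn
  rw [tndi_eq h fun j cv ce hj => hj.le_of_wheelGraph_boxProd hm hn,
    maxDeg_wheelGraph_boxProd hm hn]
  refine ⟨fun h => if_pos h, fun h => if_neg (by omega), ?_⟩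
  split_ifs <;> omega
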